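/- Let c_1,...,c_h ∈ F_q^k be vectors with supports matching a bipartite graph G that are in general position, with Γ(j) nonempty for every j ∈ [h], and consider the code whose point set is {e_1,...,e_k, c_1,...,c_h} (e_i the standard basis vectors of F_q^k). Then for every j ∈ [h], the locality of the point c_j in this code is exactly |Γ(j)| (the degree of j in G). -/

import Mathlib

open Matrix Finset

/-- The vectors `c_1, ..., c_h ∈ F^k` have supports matching the bipartite graph `G`
    given by neighborhoods `Γ : Fin h → Finset (Fin k)`. -/
def SupportsMatch {k h : ℕ} {F : Type} [Field F]
    (Γ : Fin h → Finset (Fin k)) (c : Fin h → Fin k → F) : Prop :=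
  ∀ (j : Fin h) (i : Fin k), c j i ≠ 0 ↔ i ∈ Γ j

/-- The vectors `c_1, ..., c_h` (with supports matching the graph Γ) are in general
    position: for every `I ⊆ [k]` and matching `m` of `I` into `[h]` (so `J = m(I)`),
    the square submatrix `C_{I,J}` is invertible. -/
def GeneralPosition {k h : ℕ} {F : Type} [Field F]
    (Γ : Fin h → Finset (Fin k)) (c : Fin h → Fin k → F) : Prop :=
  ∀ (I : Finset (Fin k)) (m : Fin k → Fin h),
    Set.InjOn m ↑I → (∀ i ∈ I, i ∈ Γ (m i)) →
    IsUnit (Matrix.of fun a b : ↥I => c (m ↑b) ↑a).det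

/-- `loc(p_i) ≤ r` for a code with points `p` indexed by an arbitrary finite type. -/
def LocLE {ι : Type} [DecidableEq ι] {k : ℕ} {F : Type} [Field F]
    (p : ι → Fin k → F) (i : ι) (r : ℕ) : Prop :=
  ∃ R : Finset ι, i ∉ R ∧ R.card ≤ r ∧
    ∃ lam : ι → F, p i = ∑ j ∈ R, lam j • p j

/-- A subfamily of vectors that is linearly independent and supported on the sets `t b` admits a
system of distinct representatives of those sets. -/
theorem exists_injective_of_linearIndepOn {ι κ F : Type*} [Field F] [Fintype κ] [DecidableEq κ]
    (t : ι → Finset κ) (d : ι → κ → F) (hd : ∀ b i, d b i ≠ 0 → i ∈ t b)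
    {B : Finset ι} (hB : LinearIndepOn F d (B : Set ι)) :
    ∃ f : B → κ, Function.Injective f ∧ ∀ b : B, f b ∈ t b := by
  refine (Finset.all_card_le_biUnion_card_iff_exists_injective fun b : B => t b).mp fun s => ?_
  have hs : LinearIndependent F fun b : s => d b := hB.comp _ Subtype.val_injective
  set U := s.biUnion fun b : B => t b
  have hspan : Set.range (fun b : s => d b) ⊆
      Submodule.span F (Set.range fun i : U => (Pi.single (i : κ) 1 : κ → F)) := by
    rintro _ ⟨b, rfl⟩
    change d b ∈ _
    rw [pi_eq_sum_univ' (d b)]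
    refine Submodule.sum_mem _ fun i _ => ?_
    by_cases hi : d b i = 0
    · simp [hi]
    · refine Submodule.smul_mem _ _ (Submodule.subset_span ⟨⟨i, ?_⟩, ?_⟩)
      · exact Finset.mem_biUnion.mpr ⟨b, b.2, hd _ _ hi⟩
      · ext x
        simp [Pi.single_apply, eq_comm]
  classical
  have := linearIndependent_le_span_aux' _ hs _ hspan
  simpa using this.trans (Fintype.card_range_le _)

/-- In general position, a column `c j` that, outside the rows `A`, agrees with a linear
combination of the other columns in `B` has degree at most `|A| + |B|`. -/
theorem card_le_of_eq_sum_off {F : Type} [Field F] {k h : ℕ}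
    {Γ : Fin h → Finset (Fin k)} {c : Fin h → Fin k → F}
    (hmatch : SupportsMatch Γ c) (hgen : GeneralPosition Γ c) {j : Fin h}
    (A : Finset (Fin k)) (B : Finset (Fin h)) (hj : j ∉ B) (μ : Fin h → F)
    (hsum : ∀ i ∉ A, c j i = ∑ b ∈ B, μ b * c b i) :
    (Γ j).card ≤ A.card + B.card := by
  classical
  by_contra! hlt
  let d : Fin h → Fin k → F := fun b i => if i ∈ A then 0 else c b i
  have hdspan : d j ∈ Submodule.span F (d '' (B : Set (Fin h))) := by
    have : d j = ∑ b ∈ B, μ b • d b := by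
      ext i
      by_cases hi : i ∈ A <;> simp [d, hi, hsum]
    rw [this]
    exact Submodule.sum_mem _ fun b hb =>
      Submodule.smul_mem _ _ (Submodule.subset_span ⟨b, hb, rfl⟩)
  obtain ⟨S, hSB, -, hspan, hS⟩ :=
    exists_linearIndepOn_extension (linearIndepOn_empty F d) (Set.empty_subset (B : Set (Fin h)))
  lift S to Finset (Fin h) using S.toFinite
  have hSB : S ⊆ B := by exact_mod_cast hSB
  have hjS : j ∉ S := fun hjS => hj (hSB hjS)
  obtain ⟨ν, hν⟩ := (Submodule.mem_span_image_finset_iff_exists_fun' F).mp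
    (Submodule.span_le.mpr hspan hdspan)
  obtain ⟨f, hf, hft⟩ := exists_injective_of_linearIndepOn (fun b => Γ b \ A) d (fun b i hbi => by
    by_cases hi : i ∈ A <;> simp_all [d, ← hmatch b i]) hS
  set T := Finset.univ.image f with hT
  have hTcard : T.card = S.card := by simp [hT, Finset.card_image_of_injective _ hf]
  obtain ⟨i₀, hi₀, hi₀AT⟩ : ∃ i ∈ Γ j, i ∉ A ∪ T := Finset.exists_mem_notMem_of_card_lt_card <|
    (Finset.card_union_le _ _).trans_lt <| by
      have := Finset.card_le_card hSB
      omega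
  rw [Finset.mem_union, not_or] at hi₀AT
  let m : Fin k → Fin h := Function.extend f (↑) fun _ => j
  have hmf (b : S) : m (f b) = b := hf.extend_apply _ _ b
  have hmi₀ : m i₀ = j := Function.extend_apply' _ _ _ fun ⟨b, hb⟩ => hi₀AT.2 (by simp [hT, ← hb])
  have hdet : IsUnit (Matrix.of fun a b : ↥(insert i₀ T) => c (m ↑b) ↑a).det := by
    refine hgen _ m ?_ ?_
    · rw [Finset.coe_insert, Set.injOn_insert (by simpa using hi₀AT.2)]
      constructor
      · intro x hx y hy hxy
        obtain ⟨x, -, rfl⟩ := Finset.mem_image.mp hx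
        obtain ⟨y, -, rfl⟩ := Finset.mem_image.mp hy
        rw [hmf, hmf] at hxy
        rw [Subtype.ext hxy]
      · rintro ⟨x, hx, hxj⟩
        obtain ⟨x, -, rfl⟩ := Finset.mem_image.mp hx
        rw [hmf, hmi₀] at hxj
        exact hjS (hxj ▸ x.2)
    · intro i hi
      obtain rfl | hi := Finset.mem_insert.mp hi
      · rwa [hmi₀]
      · obtain ⟨b, -, rfl⟩ := Finset.mem_image.mp hi
        rw [hmf]
        exact (Finset.mem_sdiff.mp (hft b)).1
  let v : Fin h → F := fun b => if b = j then -1 else ν b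
  refine hdet.ne_zero (Matrix.exists_mulVec_eq_zero_iff.mp ⟨fun b => v (m b), ?_, ?_⟩)
  · intro hv
    simpa [v, hmi₀] using congrFun hv ⟨i₀, Finset.mem_insert_self _ _⟩
  · ext ⟨a, ha⟩
    have haA : a ∉ A := by
      obtain rfl | ha := Finset.mem_insert.mp ha
      · exact hi₀AT.1
      · obtain ⟨b, -, rfl⟩ := Finset.mem_image.mp ha
        exact (Finset.mem_sdiff.mp (hft b)).2
    have hνa : ∑ b ∈ S, ν b * c b a = c j a := by
      simpa [d, haA] using congrFun hν a
    have hvS : ∑ b ∈ S, c b a * v b = c j a := by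
      rw [← hνa]
      refine Finset.sum_congr rfl fun b hb => ?_
      rw [show v b = ν b from if_neg (ne_of_mem_of_not_mem hb hjS), mul_comm]
    have hsplit : ∑ b ∈ insert i₀ T, c (m b) a * v (m b) = 0 := by
      rw [Finset.sum_insert hi₀AT.2, hT, Finset.sum_image hf.injOn]
      simp only [hmf, hmi₀]
      rw [Finset.sum_coe_sort S fun b => c b a * v b, hvS]
      simp [v]
    simpa [Matrix.mulVec, dotProduct] using
      (Finset.sum_coe_sort (insert i₀ T) fun b => c (m b) a * v (m b)).trans hsplit

/-- In a generalized pyramid code (points `e_1, ..., e_k, c_1, ..., c_h` with the `c_j`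
    in general position with supports matching `G`), the locality of the parity point
    `c_j` is exactly `deg(j) = |Γ(j)|`. -/
theorem generalized_pyramid_parity_locality
    {F : Type} [Field F] [Fintype F] [DecidableEq F]
    {k h : ℕ}
    (Γ : Fin h → Finset (Fin k)) (c : Fin h → Fin k → F)
    (hΓ : ∀ j, (Γ j).Nonempty)
    (hmatch : SupportsMatch Γ c) (hgen : GeneralPosition Γ c) :
    ∀ j : Fin h,
      LocLE (Sum.elim (fun i : Fin k => (Pi.single i 1 : Fin k → F)) c) (Sum.inr j)
        (Γ j).card ∧
      ∀ m : ℕ,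
        LocLE (Sum.elim (fun i : Fin k => (Pi.single i 1 : Fin k → F)) c) (Sum.inr j) m →
        (Γ j).card ≤ m := by
  intro j
  refine ⟨⟨(Γ j).map Function.Embedding.inl, by simp, by simp, Sum.elim (c j) 0, ?_⟩, ?_⟩
  · ext i
    have hi : i ∉ Γ j → c j i = 0 := fun hi => by rwa [← hmatch j i, not_not] at hi
    simpa [Pi.single_apply] using hi
  · rintro m ⟨R, hjR, hRm, lam, hlam⟩
    refine le_trans ?_ (R.card_toLeft_add_card_toRight.trans_le hRm)
    refine card_le_of_eq_sum_off hmatch hgen _ _ (by simpa using hjR) (fun b => lam (.inr b)) ?_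
    intro i hi
    have hsum := congrFun hlam i
    rw [← R.toLeft_disjSum_toRight, Finset.sum_disjSum] at hsum
    simp_all [Pi.single_apply]
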